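/- arXiv:1510.02318 — 4 statements merged into one kernel-verified Lean document; each statement's English description precedes it below -/
import Mathlib

section
/- Let Y be a binary random variable taking each of its two values with positive probability and let X be a finite-valued random variable not independent of Y. Then C_X(Y) = H(Y), i.e., D_X(Y) = 0. -/
open scoped BigOperators Classical

/-- Shannon entropy (base 2) of a distribution on a finite alphabet,
with the convention `0 * logb 2 0 = 0`. -/
noncomputable def H {α : Type*} [Fintype α] (p : α → ℝ) : ℝ :=
  ∑ a, -(p a * Real.logb 2 (p a))

/-- `p` is a probability mass function on a finite alphabet. -/
def IsPMF {α : Type*} [Fintype α] (p : α → ℝ) : Prop :=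
  (∀ a, 0 ≤ p a) ∧ ∑ a, p a = 1

/-- First marginal of a joint distribution. -/
noncomputable def fstM {α β : Type*} [Fintype α] [Fintype β] (p : α × β → ℝ) : α → ℝ :=
  fun a => ∑ b, p (a, b)

/-- Second marginal of a joint distribution. -/
noncomputable def sndM {α β : Type*} [Fintype α] [Fintype β] (p : α × β → ℝ) : β → ℝ :=
  fun b => ∑ a, p (a, b)

/-- Mutual information (base 2) of a joint distribution. -/
noncomputable def MI {α β : Type*} [Fintype α] [Fintype β] (p : α × β → ℝ) : ℝ :=
  H (fstM p) + H (sndM p) - H p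

/-- Marginal on the first two coordinates of a triple. -/
noncomputable def m12 {α β γ : Type*} [Fintype α] [Fintype β] [Fintype γ]
    (q : α × β × γ → ℝ) : α × β → ℝ := fun ab => ∑ c, q (ab.1, ab.2, c)

/-- Marginal on the first and third coordinates of a triple. -/
noncomputable def m13 {α β γ : Type*} [Fintype α] [Fintype β] [Fintype γ]
    (q : α × β × γ → ℝ) : α × γ → ℝ := fun ac => ∑ b, q (ac.1, b, ac.2)

/-- Marginal on the last two coordinates of a triple. -/
noncomputable def m23 {α β γ : Type*} [Fintype α] [Fintype β] [Fintype γ]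
    (q : α × β × γ → ℝ) : β × γ → ℝ := fun bc => ∑ a, q (a, bc.1, bc.2)

/-- `A → B → C` is a Markov chain for a joint distribution `q` on `α × β × γ`:
`A` and `C` are conditionally independent given the middle variable `B`. -/
def Markov {α β γ : Type*} [Fintype α] [Fintype β] [Fintype γ]
    (q : α × β × γ → ℝ) : Prop :=
  ∀ a b c, q (a, b, c) * (∑ a', ∑ c', q (a', b, c')) =
    (∑ c', q (a, b, c')) * (∑ a', q (a', b, c))

/-- The set of achievable utilities `I(Y;Z)` over finite-valued `Z` with
`X → Y → Z` a Markov chain and privacy leakage `I(X;Z) ≤ ε`. -/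
def PrivSet {α β : Type*} [Fintype α] [Fintype β] (ε : ℝ) (p : α × β → ℝ) : Set ℝ :=
  { r | ∃ (γ : Type) (_ : Fintype γ) (q : α × β × γ → ℝ),
      IsPMF q ∧ m12 q = p ∧ Markov q ∧ MI (m13 q) ≤ ε ∧ r = MI (m23 q) }

/-- The rate-privacy function `g_ε(X;Y)`. -/
noncomputable def g {α β : Type*} [Fintype α] [Fintype β] (ε : ℝ) (p : α × β → ℝ) : ℝ :=
  sSup (PrivSet ε p)

/-- The conditional distribution `P_{X|Y}(·|y)` (the zero map if `P_Y(y) = 0`). -/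
noncomputable def condX {α β : Type*} [Fintype α] [Fintype β] (p : α × β → ℝ) (y : β) :
    α → ℝ := fun x => p (x, y) / sndM p y

/-- `X` is weakly independent of `Y`: the family of conditional distributions
`P_{X|Y}(·|y)`, for `y` in the support of `P_Y`, is linearly dependent. -/
def WeaklyIndep {α β : Type*} [Fintype α] [Fintype β] (p : α × β → ℝ) : Prop :=
  ¬ LinearIndependent ℝ (fun y : {y : β // 0 < sndM p y} => condX p y.1)

/-- `C_X(Y)`: the minimum of `H(W)` over finite-valued `W` with `X → W → Y` a
Markov chain and `H(W|Y) = 0`, i.e. `W = f(Y)` for a deterministic `f`. -/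
noncomputable def Cmin {α β : Type*} [Fintype α] [Fintype β] (p : α × β → ℝ) : ℝ :=
  sInf { r | ∃ (γ : Type) (_ : Fintype γ) (f : β → γ),
      Markov (fun xwy : α × γ × β => if f xwy.2.2 = xwy.2.1 then p (xwy.1, xwy.2.2) else 0) ∧
      r = H (fun w : γ => ∑ y, if f y = w then sndM p y else 0) }

/-- Common entropy `G(X;Y)`: the minimum of `H(W)` over finite-valued `W`
with `X → W → Y` a Markov chain. -/
noncomputable def Gmin {α β : Type*} [Fintype α] [Fintype β] (p : α × β → ℝ) : ℝ :=
  sInf { r | ∃ (γ : Type) (_ : Fintype γ) (q : α × γ × β → ℝ),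
      IsPMF q ∧ m13 q = p ∧ Markov q ∧ r = H (fstM (m23 q)) }

/-- Entropy of the push-forward of the distribution `pY` under the map `f`. -/
noncomputable def Hpush {β S : Type*} [Fintype β] (pY : β → ℝ) (f : β → S) : ℝ :=
  letI := Classical.decEq S
  ∑ t ∈ Finset.image f Finset.univ,
    -((∑ y ∈ Finset.univ.filter fun y => f y = t, pY y) *
      Real.logb 2 (∑ y ∈ Finset.univ.filter fun y => f y = t, pY y))

/-- An injective relabelling preserves entropy. -/
theorem H_pushforward_of_injective {β γ : Type*} [Fintype β] [Fintype γ] (r : β → ℝ)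
    {f : β → γ} (hf : Function.Injective f) :
    H (fun w : γ => ∑ y, if f y = w then r y else 0) = H r := by
  unfold H
  symm
  apply Fintype.sum_of_injective f hf
  · intro w hw
    have h : ∀ y, f y ≠ w := fun y hy => hw ⟨y, hy⟩
    simp [h]
  · intro y
    simp [hf.eq_iff]

/-- `X → f(Y) → Y` is a Markov chain when `f` is injective. -/
theorem markov_of_injective {α β γ : Type*} [Fintype α] [Fintype β] [Fintype γ]
    (p : α × β → ℝ) {f : β → γ} (hf : Function.Injective f) :
    Markov (fun xwy : α × γ × β =>
      if f xwy.2.2 = xwy.2.1 then p (xwy.1, xwy.2.2) else 0) := by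
  intro x w y
  by_cases h : f y = w
  · subst h
    simp [hf.eq_iff]
  · simp [h]

/-- If `X → f(Y) → Y` is a Markov chain with `f` constant, then `X` and `Y` are independent. -/
theorem eq_mul_of_markov_const {α β γ : Type*} [Fintype α] [Fintype β] [Fintype γ]
    {p : α × β → ℝ} (hp : IsPMF p) {f : β → γ} {w : γ} (hf : ∀ y, f y = w)
    (hM : Markov (fun xwy : α × γ × β =>
      if f xwy.2.2 = xwy.2.1 then p (xwy.1, xwy.2.2) else 0)) (x : α) (y : β) :
    p (x, y) = fstM p x * sndM p y := by
  have h := hM x w y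
  simp only [hf, if_true] at h
  rwa [← Fintype.sum_prod_type', hp.2, mul_one] at h

/-- If `Y` is binary, taking each value with positive
probability, and `X` is not independent of `Y`, then `C_X(Y) = H(Y)`,
i.e. `D_X(Y) = 0`. -/
theorem stmt15 {𝒳 : Type*} [Fintype 𝒳] (p : 𝒳 × Bool → ℝ) (hp : IsPMF p)
    (hpos : ∀ y : Bool, 0 < sndM p y)
    (hdep : ¬ ∀ x y, p (x, y) = fstM p x * sndM p y) :
    Cmin p = H (sndM p) ∧ H (sndM p) - Cmin p = 0 := by
  have key : Cmin p = H (sndM p) := by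
    unfold Cmin
    rw [← csInf_singleton (H (sndM p))]
    congr 1
    ext r
    simp only [Set.mem_ofPred_eq, Set.mem_singleton_iff]
    constructor
    · rintro ⟨γ, _, f, hM, rfl⟩
      by_cases hf : f true = f false
      · exact absurd (eq_mul_of_markov_const hp (w := f false)
          (Bool.forall_bool.2 ⟨rfl, hf⟩) hM) hdep
      · apply H_pushforward_of_injective
        rintro (_ | _) (_ | _) h <;> simp_all
    · rintro rfl
      exact ⟨Bool, inferInstance, id, markov_of_injective p Function.injective_id,
        (H_pushforward_of_injective _ Function.injective_id).symm⟩
  exact ⟨key, by rw [key, sub_self]⟩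
end

section
/- Let X be Bernoulli(p) with 0 < p < 1 and let Y ∈ {0, e, 1} be the output of a binary erasure channel with input X and erasure probability δ ∈ (0,1), i.e., P(Y = x | X = x) = 1 − δ and P(Y = e | X = x) = δ for x ∈ {0,1}. Then g_0(X;Y) = h(δ), where h(δ) := −δ log₂ δ − (1−δ) log₂(1−δ); moreover C_X(Y) = H(Y), so D_X(Y) = 0. -/
open scoped BigOperators Classical

/-- The summand `-x log₂ x` of the Shannon entropy. -/
noncomputable def entropyTerm (x : ℝ) : ℝ := -(x * Real.logb 2 x)

lemma H_eq_sum_entropyTerm {α : Type*} [Fintype α] (p : α → ℝ) :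
    H p = ∑ a, entropyTerm (p a) := rfl

@[simp] lemma entropyTerm_zero : entropyTerm 0 = 0 := by simp [entropyTerm]

lemma entropyTerm_mul (x y : ℝ) :
    entropyTerm (x * y) = y * entropyTerm x + x * entropyTerm y := by
  unfold entropyTerm
  rcases eq_or_ne x 0 with rfl | hx
  · simp
  rcases eq_or_ne y 0 with rfl | hy
  · simp
  rw [Real.logb_mul hx hy]
  ring

lemma entropyTerm_add_le {x y : ℝ} (hx : 0 ≤ x) (hy : 0 ≤ y) :
    entropyTerm (x + y) ≤ entropyTerm x + entropyTerm y := by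
  rcases hx.eq_or_lt with rfl | hx
  · simp
  rcases hy.eq_or_lt with rfl | hy
  · simp
  unfold entropyTerm
  have h1 : Real.logb 2 x ≤ Real.logb 2 (x + y) :=
    Real.logb_le_logb_of_le (by norm_num) hx (by linarith)
  have h2 : Real.logb 2 y ≤ Real.logb 2 (x + y) :=
    Real.logb_le_logb_of_le (by norm_num) hy (by linarith)
  nlinarith [mul_le_mul_of_nonneg_left h1 hx.le, mul_le_mul_of_nonneg_left h2 hy.le]

lemma MI_mul {α β : Type*} [Fintype α] [Fintype β] (a : α → ℝ) (b : β → ℝ)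
    (ha : ∑ x, a x = 1) (hb : ∑ y, b y = 1) :
    MI (fun xy : α × β => a xy.1 * b xy.2) = 0 := by
  have h1 : fstM (fun xy : α × β => a xy.1 * b xy.2) = a := by
    funext x; simp [fstM, ← Finset.mul_sum, hb]
  have h2 : sndM (fun xy : α × β => a xy.1 * b xy.2) = b := by
    funext y; simp [sndM, ← Finset.sum_mul, ha]
  rw [MI, h1, h2]
  simp only [H_eq_sum_entropyTerm, Fintype.sum_prod_type, entropyTerm_mul,
    Finset.sum_add_distrib, ← Finset.mul_sum, ← Finset.sum_mul, ha, hb]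
  ring

lemma MI_eq_sum {α β : Type*} [Fintype α] [Fintype β] (p : α × β → ℝ) :
    MI p = ∑ x, ∑ y, (p (x, y) * Real.logb 2 (p (x, y)) - p (x, y) * Real.logb 2 (fstM p x)
      - p (x, y) * Real.logb 2 (sndM p y)) := by
  have h1 : H (fstM p) = -∑ x, ∑ y, p (x, y) * Real.logb 2 (fstM p x) := by
    simp only [H, Finset.sum_neg_distrib, ← Finset.sum_mul]
    rfl
  have h2 : H (sndM p) = -∑ x, ∑ y, p (x, y) * Real.logb 2 (sndM p y) := by
    rw [Finset.sum_comm]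
    simp only [H, Finset.sum_neg_distrib, ← Finset.sum_mul]
    rfl
  rw [MI, h1, h2]
  simp only [H, Fintype.sum_prod_type, Finset.sum_neg_distrib, Finset.sum_sub_distrib]
  ring

lemma sub_le_mul_log_sub {p a b : ℝ} (hp : 0 ≤ p) (ha : p ≤ a) (hb : p ≤ b) :
    p - a * b ≤ p * Real.log p - p * Real.log a - p * Real.log b ∧
      (p * Real.log p - p * Real.log a - p * Real.log b ≤ p - a * b → p = a * b) := by
  rcases hp.eq_or_lt with rfl | hp
  · have : 0 ≤ a * b := mul_nonneg ha hb
    constructor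
    · simp [this]
    · intro h; simp at h; linarith
  have ha' : 0 < a := by linarith
  have hb' : 0 < b := by linarith
  have hu : 0 < a * b / p := by positivity
  have hlog : Real.log (a * b / p) = Real.log a + Real.log b - Real.log p := by
    rw [Real.log_div (by positivity) hp.ne', Real.log_mul ha'.ne' hb'.ne']
  have hpu : p * (a * b / p) = a * b := by field_simp
  constructor
  · have := mul_le_mul_of_nonneg_left (Real.log_le_sub_one_of_pos hu) hp.le
    rw [hlog] at this
    nlinarith
  · intro h
    by_contra hne
    have hu1 : a * b / p ≠ 1 := by
      intro h1; rw [h1] at hpu; exact hne (by linarith)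
    have := mul_lt_mul_of_pos_left (Real.log_lt_sub_one_of_pos hu hu1) hp
    rw [hlog] at this
    nlinarith

lemma eq_mul_of_MI_nonpos {α β : Type*} [Fintype α] [Fintype β] {p : α × β → ℝ}
    (hp : IsPMF p) (hMI : MI p ≤ 0) (x : α) (y : β) : p (x, y) = fstM p x * sndM p y := by
  have hfst : ∀ x y, p (x, y) ≤ fstM p x := fun x y =>
    Finset.single_le_sum (f := fun y => p (x, y)) (fun _ _ => hp.1 _) (Finset.mem_univ y)
  have hsnd : ∀ x y, p (x, y) ≤ sndM p y := fun x y =>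
    Finset.single_le_sum (f := fun x => p (x, y)) (fun _ _ => hp.1 _) (Finset.mem_univ x)
  have hsum := hp.2
  rw [Fintype.sum_prod_type] at hsum
  have hs1 : ∑ x, fstM p x = 1 := hsum
  have hs2 : ∑ y, sndM p y = 1 := by rw [← hsum, Finset.sum_comm]; rfl
  let D : α × β → ℝ := fun z => p z * Real.log (p z) - p z * Real.log (fstM p z.1)
    - p z * Real.log (sndM p z.2) - (p z - fstM p z.1 * sndM p z.2)
  have hterm := fun z : α × β => sub_le_mul_log_sub (hp.1 z) (hfst z.1 z.2) (hsnd z.1 z.2)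
  have hD : ∀ z, 0 ≤ D z := fun z => sub_nonneg.2 (hterm z).1
  have hlog2 : 0 < Real.log 2 := Real.log_pos (by norm_num)
  have hDsum : ∑ z, D z = MI p * Real.log 2 := by
    have hprod : ∑ x, ∑ y, (p (x, y) - fstM p x * sndM p y) = 0 := by
      simp only [Finset.sum_sub_distrib, ← Finset.mul_sum, hs2, hsum, mul_one, hs1, sub_self]
    rw [MI_eq_sum, Fintype.sum_prod_type, ← sub_zero (_ * Real.log 2), ← hprod]
    simp only [Finset.sum_mul, ← Finset.sum_sub_distrib]
    refine Finset.sum_congr rfl fun x _ => Finset.sum_congr rfl fun y _ => ?_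
    simp only [D, Real.logb]
    field_simp
  have hle : ∑ z, D z ≤ 0 := by rw [hDsum]; nlinarith
  have hzero : D (x, y) ≤ 0 :=
    (Finset.single_le_sum (fun z _ => hD z) (Finset.mem_univ (x, y))).trans hle
  exact (hterm (x, y)).2 (sub_nonpos.1 hzero)

lemma H_map_of_injective {β γ : Type*} [Fintype β] [Fintype γ] (p : β → ℝ) {f : β → γ}
    (hf : Function.Injective f) : H (fun w : γ => ∑ y, if f y = w then p y else 0) = H p := by
  symm
  refine Fintype.sum_of_injective f hf _ _ (fun w hw => ?_) (fun y => ?_)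
  · have : ∀ y, f y ≠ w := fun y hy => hw ⟨y, hy⟩
    simp [this]
  · simp [hf.eq_iff]

/-- The law of a Bernoulli variable on `Bool`. -/
noncomputable def bernoulliLaw (p₀ : ℝ) (b : Bool) : ℝ := if b then p₀ else 1 - p₀

lemma sum_bernoulliLaw (p₀ : ℝ) : ∑ b, bernoulliLaw p₀ b = 1 := by simp [bernoulliLaw]

lemma bernoulliLaw_pos {p₀ : ℝ} (hp₀ : 0 < p₀) (hp₁ : p₀ < 1) (b : Bool) :
    0 < bernoulliLaw p₀ b := by
  cases b <;> simp [bernoulliLaw, hp₀, hp₁]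

/-- If `Y` is, conditionally on not being erased, Bernoulli and independent of `Z`, then
`I(Y;Z)` is the binary entropy of the erasure event minus a mixing defect. -/
lemma MI_erasure {γ : Type*} [Fintype γ] (p₀ δ : ℝ) (s t : γ → ℝ)
    (hs : ∑ z, s z = δ) (ht : ∑ z, t z = 1 - δ) (r : Option Bool × γ → ℝ)
    (hr0 : ∀ z, r (none, z) = s z) (hr1 : ∀ b z, r (some b, z) = bernoulliLaw p₀ b * t z) :
    MI r = entropyTerm δ + entropyTerm (1 - δ) +
      ∑ z, (entropyTerm (s z + t z) - entropyTerm (s z) - entropyTerm (t z)) := by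
  have hb := sum_bernoulliLaw p₀
  rw [Fintype.sum_bool] at hb
  have h0 : fstM r none = δ := by simp [fstM, hr0, hs]
  have h1 : ∀ b, fstM r (some b) = bernoulliLaw p₀ b * (1 - δ) := by
    intro b; simp [fstM, hr1, ← Finset.mul_sum, ht]
  have h2 : ∀ z, sndM r z = s z + t z := by
    intro z
    simp only [sndM, Fintype.sum_option, Fintype.sum_bool, hr0, hr1, ← add_mul, hb, one_mul]
  simp only [MI, H_eq_sum_entropyTerm, Fintype.sum_prod_type, Fintype.sum_option,
    Fintype.sum_bool, h0, h1, h2, hr0, hr1, entropyTerm_mul, Finset.sum_add_distrib,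
    Finset.sum_sub_distrib, ← Finset.mul_sum, ← Finset.sum_mul, ht]
  linear_combination (entropyTerm (1 - δ) - ∑ z, entropyTerm (t z)) * hb

section ErasureChannel

variable {p₀ δ : ℝ} {P : Bool × Option Bool → ℝ}

lemma erasure_sndM_none (hP0 : ∀ x, P (x, none) = bernoulliLaw p₀ x * δ) :
    sndM P none = δ := by
  simp only [sndM, hP0, ← Finset.sum_mul, sum_bernoulliLaw, one_mul]

lemma erasure_sndM_some
    (hP1 : ∀ x y, P (x, some y) = if y = x then bernoulliLaw p₀ x * (1 - δ) else 0) (b : Bool) :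
    sndM P (some b) = bernoulliLaw p₀ b * (1 - δ) := by
  cases b <;> simp [sndM, hP1]

lemma erasure_fstM (hP0 : ∀ x, P (x, none) = bernoulliLaw p₀ x * δ)
    (hP1 : ∀ x y, P (x, some y) = if y = x then bernoulliLaw p₀ x * (1 - δ) else 0) (x : Bool) :
    fstM P x = bernoulliLaw p₀ x := by
  cases x <;> simp [fstM, Fintype.sum_option, hP0, hP1] <;> ring

lemma erasure_nonneg (hp₀ : 0 < p₀) (hp₁ : p₀ < 1) (hδ₀ : 0 < δ) (hδ₁ : δ < 1)
    (hP0 : ∀ x, P (x, none) = bernoulliLaw p₀ x * δ)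
    (hP1 : ∀ x y, P (x, some y) = if y = x then bernoulliLaw p₀ x * (1 - δ) else 0)
    (xy : Bool × Option Bool) : 0 ≤ P xy := by
  have hpos := bernoulliLaw_pos hp₀ hp₁
  obtain ⟨x, _ | y⟩ := xy
  · rw [hP0]; exact (mul_pos (hpos x) hδ₀).le
  · rw [hP1]; split_ifs
    exacts [(mul_pos (hpos x) (by linarith)).le, le_rfl]

lemma privSet_erasure_le (hp₀ : 0 < p₀) (hp₁ : p₀ < 1) (hδ₀ : 0 < δ) (hδ₁ : δ < 1)
    (hP0 : ∀ x, P (x, none) = bernoulliLaw p₀ x * δ)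
    (hP1 : ∀ x y, P (x, some y) = if y = x then bernoulliLaw p₀ x * (1 - δ) else 0)
    {r : ℝ} (hr : r ∈ PrivSet 0 P) : r ≤ entropyTerm δ + entropyTerm (1 - δ) := by
  obtain ⟨γ, _, q, hq, hm, hM, hMI, rfl⟩ := hr
  have hpos := bernoulliLaw_pos hp₀ hp₁
  have hm' : ∀ x y, ∑ c, q (x, y, c) = P (x, y) := fun x y => congrFun hm (x, y)
  have hM' : ∀ x y z, q (x, y, z) * sndM P y = P (x, y) * m23 q (y, z) := by
    intro x y z
    have h := hM x y z
    simp only [hm'] at h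
    exact h
  have hnone : ∀ x z, q (x, none, z) = bernoulliLaw p₀ x * m23 q (none, z) := by
    intro x z
    have h := hM' x none z
    rw [erasure_sndM_none hP0, hP0] at h
    exact mul_right_cancel₀ hδ₀.ne' (by linear_combination h)
  have hsome : ∀ x y z, y ≠ x → q (x, some y, z) = 0 := by
    intro x y z hxy
    have h := hM' x (some y) z
    rw [erasure_sndM_some hP1, hP1, if_neg hxy, zero_mul] at h
    exact (mul_eq_zero.1 h).resolve_right (mul_pos (hpos y) (by linarith)).ne'
  have hdiag : ∀ x z, m23 q (some x, z) = q (x, some x, z) := by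
    intro x z
    cases x <;> simp [m23, hsome]
  have hfst : ∀ x, fstM (m13 q) x = bernoulliLaw p₀ x := by
    intro x
    rw [← erasure_fstM hP0 hP1 x]
    simp only [fstM, m13, ← hm']
    exact Finset.sum_comm
  have hpmf : IsPMF (m13 q) := by
    refine ⟨fun a => Finset.sum_nonneg fun _ _ => hq.1 _, ?_⟩
    rw [Fintype.sum_prod_type]
    change ∑ x, fstM (m13 q) x = 1
    simp only [hfst, sum_bernoulliLaw]
  have hm13 : ∀ x z, m13 q (x, z) = bernoulliLaw p₀ x * m23 q (none, z) + q (x, some x, z) := by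
    intro x z
    cases x <;> simp [m13, Fintype.sum_option, hnone, hsome]
  set s : γ → ℝ := fun z => m23 q (none, z) with hs
  set t : γ → ℝ := fun z => sndM (m13 q) z - s z with ht
  have hr1 : ∀ b z, m23 q (some b, z) = bernoulliLaw p₀ b * t z := by
    intro b z
    have h := eq_mul_of_MI_nonpos hpmf hMI b z
    rw [hfst, hm13] at h
    rw [hdiag]
    simp only [ht, hs]
    linear_combination h
  have hs0 : ∀ z, 0 ≤ s z := fun z => Finset.sum_nonneg fun _ _ => hq.1 _
  have ht0 : ∀ z, 0 ≤ t z := fun z => by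
    have h : 0 ≤ m23 q (some true, z) := Finset.sum_nonneg fun _ _ => hq.1 _
    rw [hr1] at h
    exact nonneg_of_mul_nonneg_right h (hpos true)
  have hfst23 : ∀ y, ∑ z, m23 q (y, z) = sndM P y := by
    intro y
    simp only [m23, sndM, ← hm']
    exact Finset.sum_comm
  have hssum : ∑ z, s z = δ := (hfst23 none).trans (erasure_sndM_none hP0)
  have htsum : ∑ z, t z = 1 - δ := by
    have h := hfst23 (some true)
    simp only [hr1, ← Finset.mul_sum, erasure_sndM_some hP1] at h
    exact mul_left_cancel₀ (hpos true).ne' h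
  rw [MI_erasure p₀ δ s t hssum htsum _ (fun _ => rfl) hr1]
  have : ∑ z, (entropyTerm (s z + t z) - entropyTerm (s z) - entropyTerm (t z)) ≤ 0 :=
    Finset.sum_nonpos fun z _ => by linarith [entropyTerm_add_le (hs0 z) (ht0 z)]
  linarith

lemma mem_privSet_erasure (hp₀ : 0 < p₀) (hp₁ : p₀ < 1) (hδ₀ : 0 < δ) (hδ₁ : δ < 1)
    (hP0 : ∀ x, P (x, none) = bernoulliLaw p₀ x * δ)
    (hP1 : ∀ x y, P (x, some y) = if y = x then bernoulliLaw p₀ x * (1 - δ) else 0) :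
    entropyTerm δ + entropyTerm (1 - δ) ∈ PrivSet 0 P := by
  have hP := erasure_nonneg hp₀ hp₁ hδ₀ hδ₁ hP0 hP1
  have hm : m12 (fun a : Bool × Option Bool × Bool =>
      if a.2.2 = a.2.1.isNone then P (a.1, a.2.1) else 0) = P := by
    funext ⟨x, y⟩
    simp [m12]
  refine ⟨Bool, inferInstance, fun a => if a.2.2 = a.2.1.isNone then P (a.1, a.2.1) else 0,
    ⟨fun a => ?_, ?_⟩, hm, ?_, ?_, ?_⟩
  · dsimp only; split_ifs
    exacts [hP _, le_rfl]
  · simp only [Fintype.sum_prod_type, Finset.sum_ite_eq', Finset.mem_univ, if_true]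
    change ∑ x, fstM P x = 1
    simp only [erasure_fstM hP0 hP1, sum_bernoulliLaw]
  · intro x y z
    by_cases h : z = y.isNone <;> simp [h]
  · have h13 : m13 (fun a : Bool × Option Bool × Bool =>
        if a.2.2 = a.2.1.isNone then P (a.1, a.2.1) else 0) =
        fun xz => bernoulliLaw p₀ xz.1 * bernoulliLaw δ xz.2 := by
      funext ⟨x, z⟩
      cases x <;> cases z <;> simp [m13, Fintype.sum_option, hP0, hP1, bernoulliLaw]
    rw [h13, MI_mul _ _ (sum_bernoulliLaw _) (sum_bernoulliLaw _)]
  · rw [MI_erasure p₀ δ (fun z => if z then δ else 0) (fun z => if z then 0 else 1 - δ)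
      (by simp) (by simp)]
    · simp
    · intro z
      cases z <;> simp [m23, hP0, bernoulliLaw] <;> ring
    · intro b z
      cases b <;> cases z <;> simp [m23, hP1, bernoulliLaw]

end ErasureChannel

/-- If `X → f(Y) → Y`, letters of positive mass identified by `f` induce the same
conditional law of `X`. -/
lemma mul_sndM_comm_of_markov {α β γ : Type*} [Fintype α] [Fintype β] [Fintype γ]
    {p : α × β → ℝ} {f : β → γ} (hp : ∀ z, 0 ≤ p z)
    (hM : Markov (fun xwy : α × γ × β =>
      if f xwy.2.2 = xwy.2.1 then p (xwy.1, xwy.2.2) else 0))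
    {y₁ y₂ : β} (hf : f y₁ = f y₂) (hy : 0 < sndM p y₁) (x : α) :
    p (x, y₁) * sndM p y₂ = p (x, y₂) * sndM p y₁ := by
  have h1 := hM x (f y₁) y₁
  have h2 := hM x (f y₁) y₂
  simp only [hf, if_true] at h1 h2
  have hW : 0 < ∑ a', ∑ c', if f c' = f y₂ then p (a', c') else 0 := by
    refine hy.trans_le (Finset.sum_le_sum fun a _ => ?_)
    have := Finset.single_le_sum (f := fun c' => if f c' = f y₂ then p (a, c') else 0)
      (fun c _ => by split_ifs; exacts [hp _, le_rfl]) (Finset.mem_univ y₁)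
    simpa only [hf, if_true] using this
  refine mul_right_cancel₀ hW.ne' ?_
  unfold sndM
  linear_combination (∑ a, p (a, y₂)) * h1 - (∑ a, p (a, y₁)) * h2

lemma markov_id {α β : Type*} [Fintype α] [Fintype β] (p : α × β → ℝ) :
    Markov (fun xwy : α × β × β => if id xwy.2.2 = xwy.2.1 then p (xwy.1, xwy.2.2) else 0) := by
  intro x w y
  by_cases h : y = w
  · subst h; simp
  · simp [h]

lemma Cmin_eq_of_forall_injective {α : Type*} {β : Type} [Fintype α] [Fintype β]
    (p : α × β → ℝ)
    (hinj : ∀ (γ : Type) [Fintype γ] (f : β → γ),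
      Markov (fun xwy : α × γ × β => if f xwy.2.2 = xwy.2.1 then p (xwy.1, xwy.2.2) else 0) →
      Function.Injective f) : Cmin p = H (sndM p) := by
  refine (congrArg sInf (Set.ext fun r => ⟨?_, ?_⟩)).trans (csInf_singleton _)
  · rintro ⟨γ, _, f, hM, rfl⟩
    exact H_map_of_injective _ (hinj γ f hM)
  · rintro rfl
    exact ⟨β, inferInstance, id, markov_id p, (H_map_of_injective _ Function.injective_id).symm⟩

lemma Cmin_erasure {p₀ δ : ℝ} {P : Bool × Option Bool → ℝ}
    (hp₀ : 0 < p₀) (hp₁ : p₀ < 1) (hδ₀ : 0 < δ) (hδ₁ : δ < 1)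
    (hP0 : ∀ x, P (x, none) = bernoulliLaw p₀ x * δ)
    (hP1 : ∀ x y, P (x, some y) = if y = x then bernoulliLaw p₀ x * (1 - δ) else 0) :
    Cmin P = H (sndM P) := by
  have hpos := bernoulliLaw_pos hp₀ hp₁
  have hδ' : 0 < 1 - δ := by linarith
  have hP := erasure_nonneg hp₀ hp₁ hδ₀ hδ₁ hP0 hP1
  have hY : ∀ y, 0 < sndM P y := by
    rintro (_ | b)
    · rwa [erasure_sndM_none hP0]
    · rw [erasure_sndM_some hP1]; exact mul_pos (hpos b) hδ'
  refine Cmin_eq_of_forall_injective P fun γ _ f hM => ?_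
  have key : ∀ y₁ y₂ x, f y₁ = f y₂ → 0 < P (x, y₁) → P (x, y₂) = 0 → False := by
    intro y₁ y₂ x hf h1 h2
    have h := mul_sndM_comm_of_markov hP hM hf (hY y₁) x
    rw [h2, zero_mul] at h
    exact (mul_pos h1 (hY y₂)).ne' h
  have hnone : ∀ b, f none ≠ f (some b) := fun b hf =>
    key none (some b) (!b) hf (by rw [hP0]; exact mul_pos (hpos _) hδ₀) (by simp [hP1])
  rintro (_ | b) (_ | c) hf
  · rfl
  · exact (hnone c hf).elim
  · exact (hnone b hf.symm).elim
  · by_contra hne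
    refine key _ _ b hf (by rw [hP1, if_pos rfl]; exact mul_pos (hpos _) hδ') ?_
    rw [hP1, if_neg fun h => hne (by rw [h])]

/-- binary erasure channel example. Let `X ~ Bernoulli(p₀)`
with `0 < p₀ < 1` and let `Y ∈ {0, e, 1}` (modelled as `Option Bool`, with
`none` the erasure symbol) be the output of a binary erasure channel with
input `X` and erasure probability `δ ∈ (0,1)`.  Then `g₀(X;Y) = h(δ)` and
`C_X(Y) = H(Y)`, so `D_X(Y) = 0`. -/
theorem stmt16 (p₀ δ : ℝ) (hp₀ : 0 < p₀) (hp₁ : p₀ < 1) (hδ₀ : 0 < δ) (hδ₁ : δ < 1)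
    (P : Bool × Option Bool → ℝ)
    (hPdef : ∀ (x : Bool) (y : Option Bool),
      P (x, y) = (if x then p₀ else 1 - p₀) *
        (y.elim δ fun y' => if y' = x then 1 - δ else 0)) :
    g 0 P = -(δ * Real.logb 2 δ) - (1 - δ) * Real.logb 2 (1 - δ) ∧
    Cmin P = H (sndM P) ∧ H (sndM P) - Cmin P = 0 := by
  have hP0 : ∀ x, P (x, none) = bernoulliLaw p₀ x * δ := fun x => hPdef x none
  have hP1 : ∀ x y, P (x, some y) = if y = x then bernoulliLaw p₀ x * (1 - δ) else 0 := by
    intro x y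
    rw [hPdef]
    simp [bernoulliLaw]
  have hC := Cmin_erasure hp₀ hp₁ hδ₀ hδ₁ hP0 hP1
  refine ⟨?_, hC, by rw [hC, sub_self]⟩
  have hg : IsGreatest (PrivSet 0 P) (entropyTerm δ + entropyTerm (1 - δ)) :=
    ⟨mem_privSet_erasure hp₀ hp₁ hδ₀ hδ₁ hP0 hP1,
      fun _ hr => privSet_erasure_le hp₀ hp₁ hδ₀ hδ₁ hP0 hP1 hr⟩
  rw [g, hg.csSup_eq]
  simp only [entropyTerm]
  ring
end

section
/- (Cardinality bound) For any random variables X, Y on finite sets and any ε ≥ 0, the supremum defining g_ε(X;Y) over all finite-valued Z equals the maximum of I(Y;Z) over random variables Z taking values in an alphabet 𝒵 of cardinality |𝒵| ≤ |𝒴| + 1 such that X → Y → Z is a Markov chain and I(X;Z) ≤ ε; in particular this maximum is attained. -/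
open scoped BigOperators Classical

open Finset in
/-- A conic combination of vectors on which some linear functional is positive can be rewritten,
without decreasing a prescribed linear objective, so that at most `finrank` coefficients
are nonzero. -/
theorem exists_conic_combination_card_support_le {E γ : Type*} [AddCommGroup E] [Module ℝ E]
    [FiniteDimensional ℝ E] [Fintype γ] (v : γ → E) (f : γ → ℝ) (l : E →ₗ[ℝ] ℝ)
    (c : γ → ℝ) (hc : ∀ z, 0 ≤ c z) (hl : ∀ z, c z ≠ 0 → 0 < l (v z)) :
    ∃ c' : γ → ℝ, (∀ z, 0 ≤ c' z) ∧ ∑ z, c' z • v z = ∑ z, c z • v z ∧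
      ∑ z, c z * f z ≤ ∑ z, c' z * f z ∧ #{z | c' z ≠ 0} ≤ Module.finrank ℝ E := by
  induction hn : #{z | c z ≠ 0} using Nat.strong_induction_on generalizing c with
  | _ n ih =>
  by_cases hle : n ≤ Module.finrank ℝ E
  · exact ⟨c, hc, rfl, le_rfl, hn.trans_le hle⟩
  obtain ⟨d, hd0, hdv, hdf, z₀, hz₀⟩ : ∃ d : γ → ℝ, (∀ z, c z = 0 → d z = 0) ∧
      ∑ z, d z • v z = 0 ∧ 0 ≤ ∑ z, d z * f z ∧ ∃ z, d z ≠ 0 := by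
    have hdep : ¬ LinearIndependent ℝ (fun z : {z // c z ≠ 0} => v z) := fun h => hle <| by
      have := h.fintype_card_le_finrank
      rwa [Fintype.card_subtype, hn] at this
    obtain ⟨a, ha, z₀, hz₀⟩ := Fintype.not_linearIndependent_iff.1 hdep
    let d : γ → ℝ := fun z => if h : c z ≠ 0 then a ⟨z, h⟩ else 0
    have hd0 : ∀ z, c z = 0 → d z = 0 := fun z hz => by simp [d, hz]
    have hdv : ∑ z, d z • v z = 0 := by
      rw [← ha]
      symm
      refine Fintype.sum_of_injective Subtype.val Subtype.val_injective _ _ (fun z hz => ?_)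
        fun z => ?_
      · have : c z = 0 := by simpa using hz
        simp [hd0 z this]
      · simp [d, z.2]
    have hdz : d z₀ ≠ 0 := by simpa [d, z₀.2] using hz₀
    rcases le_total 0 (∑ z, d z * f z) with h | h
    · exact ⟨d, hd0, hdv, h, z₀, hdz⟩
    · exact ⟨-d, fun z hz => by simp [hd0 z hz], by simp [hdv], by simpa using h, z₀,
        by simpa using hdz⟩
  obtain ⟨z₁, hz₁⟩ : ∃ z, d z < 0 := by
    by_contra! hpos
    have hsum : ∑ z, d z * l (v z) = 0 := by
      simpa using congrArg l hdv
    have hnn : ∀ z, 0 ≤ d z * l (v z) := fun z => by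
      by_cases hz : c z = 0
      · simp [hd0 z hz]
      · exact mul_nonneg (hpos z) (hl z hz).le
    have h0 := (sum_eq_zero_iff_of_nonneg fun z _ => hnn z).1 hsum z₀ (mem_univ _)
    exact (mul_ne_zero hz₀ (hl z₀ fun h => hz₀ (hd0 z₀ h)).ne') h0
  obtain ⟨m, hm, hmin⟩ := exists_min_image ({z | d z < 0} : Finset γ) (fun z => c z / (-d z))
    ⟨z₁, by simpa using hz₁⟩
  simp only [mem_filter, mem_univ, true_and] at hm hmin
  set t := c m / (-d m) with ht
  have ht0 : 0 ≤ t := div_nonneg (hc m) (by linarith)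
  have hc₁ : ∀ z, 0 ≤ c z + t * d z := fun z => by
    rcases lt_or_ge (d z) 0 with h | h
    · have := (le_div_iff₀ (by linarith : 0 < -d z)).1 (hmin z h)
      linarith
    · exact add_nonneg (hc z) (mul_nonneg ht0 h)
  have hsupp : ∀ z, c z + t * d z ≠ 0 → c z ≠ 0 := fun z hz h => hz (by simp [h, hd0 z h])
  have hm0 : c m + t * d m = 0 := by
    rw [ht]
    field_simp [hm.ne]
    ring
  have hlt : #{z | c z + t * d z ≠ 0} < n := by
    rw [← hn]
    refine card_lt_card <| (ssubset_iff_of_subset fun z => ?_).2 ⟨m, ?_, ?_⟩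
    · simpa using hsupp z
    · simpa using fun h => hm.ne (hd0 m h)
    · simp [hm0]
  obtain ⟨c', h0, hv, hf, hcard⟩ :=
    ih _ hlt (fun z => c z + t * d z) hc₁ (fun z hz => hl z (hsupp z hz)) rfl
  refine ⟨c', h0, hv.trans ?_, le_trans ?_ hf, hcard⟩
  · simp only [add_smul, mul_smul, sum_add_distrib, ← smul_sum, hdv, smul_zero, add_zero]
  · simp only [add_mul, mul_assoc, sum_add_distrib, ← mul_sum]
    exact le_add_of_nonneg_right (mul_nonneg ht0 hdf)

/-- The negative conditional entropy contribution `-|w| H(w / |w|)` of a column `w` of a joint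
distribution; it is homogeneous of degree one. -/
noncomputable def negColumnEntropy {α : Type*} [Fintype α] (w : α → ℝ) : ℝ :=
  -((∑ a, w a) * Real.logb 2 (∑ a, w a)) - ∑ a, -(w a * Real.logb 2 (w a))

theorem neg_mul_logb_mul (s t : ℝ) :
    -(s * t * Real.logb 2 (s * t)) =
      s * -(t * Real.logb 2 t) + -(s * Real.logb 2 s) * t := by
  rcases eq_or_ne s 0 with rfl | hs
  · simp
  rcases eq_or_ne t 0 with rfl | ht
  · simp
  rw [Real.logb_mul hs ht]
  ring

theorem negColumnEntropy_smul {α : Type*} [Fintype α] (s : ℝ) (w : α → ℝ) :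
    negColumnEntropy (s • w) = s * negColumnEntropy w := by
  simp only [negColumnEntropy, Pi.smul_apply, smul_eq_mul, ← Finset.mul_sum, neg_mul_logb_mul,
    Finset.sum_add_distrib]
  ring

theorem negColumnEntropy_zero {α : Type*} [Fintype α] :
    negColumnEntropy (0 : α → ℝ) = 0 := by
  simp [negColumnEntropy]

theorem continuous_neg_mul_logb : Continuous fun t : ℝ => -(t * Real.logb 2 t) := by
  have : (fun t : ℝ => -(t * Real.logb 2 t)) = fun t => Real.negMulLog t / Real.log 2 := by
    ext t
    simp only [Real.negMulLog, Real.logb]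
    ring
  rw [this]
  exact Real.continuous_negMulLog.div_const _

theorem continuous_negColumnEntropy {α : Type*} [Fintype α] :
    Continuous (negColumnEntropy : (α → ℝ) → ℝ) := by
  unfold negColumnEntropy
  refine (continuous_neg_mul_logb.comp (by fun_prop : Continuous fun w : α → ℝ => ∑ a, w a)).sub ?_
  exact continuous_finsetSum _ fun a _ => continuous_neg_mul_logb.comp (continuous_apply a)

theorem MI_eq_H_add_sum_negColumnEntropy {α γ : Type*} [Fintype α] [Fintype γ]
    (r : α × γ → ℝ) :
    MI r = H (fstM r) + ∑ z, negColumnEntropy fun a => r (a, z) := by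
  have hH : H r = ∑ z, ∑ a, -(r (a, z) * Real.logb 2 (r (a, z))) := by
    rw [H, Fintype.sum_prod_type_right]
  simp only [MI, negColumnEntropy, Finset.sum_sub_distrib, hH]
  simp only [H, sndM]
  ring

section Channel

variable {α β γ : Type*} [Fintype α] [Fintype β] [Fintype γ]

/-- The law of the input of the channel `P_{X|Y}` when its output mass function is `w`. -/
noncomputable def pushX (p : α × β → ℝ) (w : β → ℝ) : α → ℝ :=
  fun x => ∑ y, condX p y x * w y

/-- The joint distribution of `X → Y → Z` when `W z y = P(Y = y, Z = z)`. -/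
noncomputable def chainLaw (p : α × β → ℝ) (W : γ → β → ℝ) : α × β × γ → ℝ :=
  fun t => condX p t.2.1 t.1 * W t.2.2 t.2.1

/-- `W` is the joint mass function of `(Z, Y)` for some `Z`, with `Y` distributed as in `p`. -/
def IsCoupling (p : α × β → ℝ) (W : γ → β → ℝ) : Prop :=
  (∀ z y, 0 ≤ W z y) ∧ ∀ y, ∑ z, W z y = sndM p y

variable {p : α × β → ℝ} {W : γ → β → ℝ}

theorem sndM_nonneg (hp : IsPMF p) (y : β) : 0 ≤ sndM p y :=
  Finset.sum_nonneg fun x _ => hp.1 (x, y)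

theorem condX_mul_sndM (hp : IsPMF p) (x : α) (y : β) :
    condX p y x * sndM p y = p (x, y) := by
  by_cases h : sndM p y = 0
  · have := (Finset.sum_eq_zero_iff_of_nonneg fun x _ => hp.1 (x, y)).1 h x (Finset.mem_univ _)
    rw [h, mul_zero, this]
  · exact div_mul_cancel₀ _ h

theorem IsCoupling.eq_zero (hW : IsCoupling p W) {y : β} (h : sndM p y = 0) (z : γ) :
    W z y = 0 :=
  (Finset.sum_eq_zero_iff_of_nonneg fun z _ => hW.1 z y).1 ((hW.2 y).trans h) z
    (Finset.mem_univ _)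

theorem IsCoupling.m23_chainLaw (hW : IsCoupling p W) :
    m23 (chainLaw p W) = fun yz => W yz.2 yz.1 := by
  ext ⟨y, z⟩
  simp only [m23, chainLaw, ← Finset.sum_mul]
  by_cases h : sndM p y = 0
  · simp [hW.eq_zero h]
  · have : ∑ x, condX p y x = 1 := by
      simp only [condX, ← Finset.sum_div]
      exact div_self h
    rw [this, one_mul]

theorem IsCoupling.m12_chainLaw (hp : IsPMF p) (hW : IsCoupling p W) :
    m12 (chainLaw p W) = p := by
  ext ⟨x, y⟩
  simp only [m12, chainLaw, ← Finset.mul_sum, hW.2, condX_mul_sndM hp]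

theorem fstM_m23 (q : α × β × γ → ℝ) : fstM (m23 q) = sndM (m12 q) := by
  ext y
  exact Finset.sum_comm

theorem fstM_m13 (q : α × β × γ → ℝ) : fstM (m13 q) = fstM (m12 q) := by
  ext y
  exact Finset.sum_comm

theorem IsCoupling.isPMF_chainLaw (hp : IsPMF p) (hW : IsCoupling p W) :
    IsPMF (chainLaw p W) := by
  refine ⟨fun t => mul_nonneg (div_nonneg (hp.1 _) (sndM_nonneg hp _)) (hW.1 _ _), ?_⟩
  rw [← hp.2, ← hW.m12_chainLaw hp]
  simp only [Fintype.sum_prod_type, m12, hW.m12_chainLaw hp]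

theorem IsCoupling.markov_chainLaw (hp : IsPMF p) (hW : IsCoupling p W) :
    Markov (chainLaw p W) := by
  intro x y z
  have h12 : ∀ x, ∑ z, chainLaw p W (x, y, z) = p (x, y) := fun x =>
    congrFun (hW.m12_chainLaw hp) (x, y)
  have h23 : ∑ x, chainLaw p W (x, y, z) = W z y := congrFun hW.m23_chainLaw (y, z)
  simp only [h12, h23]
  rw [← condX_mul_sndM hp x y]
  simp only [chainLaw, sndM]
  ring

theorem IsCoupling.MI_m23_chainLaw (hp : IsPMF p) (hW : IsCoupling p W) :
    MI (m23 (chainLaw p W)) = H (sndM p) + ∑ z, negColumnEntropy (W z) := by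
  rw [MI_eq_H_add_sum_negColumnEntropy, fstM_m23, hW.m12_chainLaw hp, hW.m23_chainLaw]

theorem IsCoupling.MI_m13_chainLaw (hp : IsPMF p) (hW : IsCoupling p W) :
    MI (m13 (chainLaw p W)) = H (fstM p) + ∑ z, negColumnEntropy (pushX p (W z)) := by
  rw [MI_eq_H_add_sum_negColumnEntropy, fstM_m13, hW.m12_chainLaw hp]
  rfl

/-- Every Markov chain `X → Y → Z` arises from a coupling of `Y` and `Z`. -/
theorem exists_isCoupling_eq_chainLaw (hp : IsPMF p) {q : α × β × γ → ℝ} (hq : IsPMF q)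
    (h12 : m12 q = p) (hM : Markov q) :
    ∃ W : γ → β → ℝ, IsCoupling p W ∧ q = chainLaw p W := by
  have hW : IsCoupling p fun z y => m23 q (y, z) :=
    ⟨fun z y => Finset.sum_nonneg fun x _ => hq.1 _, fun y => by
      rw [← h12]; exact congrFun (fstM_m23 q) y⟩
  refine ⟨_, hW, ?_⟩
  ext ⟨x, y, z⟩
  by_cases h : sndM p y = 0
  · have h0 := hW.eq_zero h z
    rw [chainLaw, h0, mul_zero]
    exact (Finset.sum_eq_zero_iff_of_nonneg fun x _ => hq.1 (x, y, z)).1 h0 x (Finset.mem_univ _)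
  · have hm : q (x, y, z) * sndM p y = p (x, y) * m23 q (y, z) := by
      subst h12
      exact hM x y z
    simp only [chainLaw, condX]
    field_simp
    exact hm

theorem pushX_smul (p : α × β → ℝ) (s : ℝ) (w : β → ℝ) : pushX p (s • w) = s • pushX p w := by
  ext x
  simp only [pushX, Pi.smul_apply, smul_eq_mul, Finset.mul_sum]
  exact Finset.sum_congr rfl fun y _ => by ring

theorem pushX_zero (p : α × β → ℝ) : pushX p 0 = 0 := by
  simpa using pushX_smul p 0 0

theorem continuous_pushX (p : α × β → ℝ) : Continuous (pushX p) := by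
  unfold pushX
  fun_prop

/-- The alphabet of `Z` can be reduced to `|𝒴| + 1` letters, keeping the leakage and without
decreasing the utility. -/
theorem IsCoupling.exists_fin (hW : IsCoupling p W) :
    ∃ W' : Fin (Fintype.card β + 1) → β → ℝ, IsCoupling p W' ∧
      ∑ i, negColumnEntropy (pushX p (W' i)) = ∑ z, negColumnEntropy (pushX p (W z)) ∧
      ∑ z, negColumnEntropy (W z) ≤ ∑ i, negColumnEntropy (W' i) := by
  let c : γ → ℝ := fun z => if W z = 0 then 0 else 1
  have hcW : ∀ z, c z • W z = W z := fun z => by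
    by_cases h : W z = 0 <;> simp [c, h]
  let l : (β → ℝ) × ℝ →ₗ[ℝ] ℝ := (∑ y, LinearMap.proj y) ∘ₗ LinearMap.fst ℝ (β → ℝ) ℝ
  obtain ⟨c', hc', hv, hf, hcard⟩ := exists_conic_combination_card_support_le
    (fun z => (W z, negColumnEntropy (pushX p (W z)))) (fun z => negColumnEntropy (W z)) l c
    (fun z => by by_cases h : W z = 0 <;> simp [c, h]) (fun z hz => by
      have hne : W z ≠ 0 := by simpa [c] using hz
      obtain ⟨y, hy⟩ := Function.ne_iff.1 hne
      simpa [l] using Finset.sum_pos' (fun y _ => hW.1 z y)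
        ⟨y, Finset.mem_univ _, (hW.1 z y).lt_of_ne' hy⟩)
  simp only [← negColumnEntropy_smul, hcW] at hf
  have hv₁ : ∑ z, c' z • W z = ∑ z, W z := by
    simpa [Prod.fst_sum, hcW] using congrArg Prod.fst hv
  have hv₂ : ∑ z, negColumnEntropy (pushX p (c' z • W z)) =
      ∑ z, negColumnEntropy (pushX p (W z)) := by
    have := congrArg Prod.snd hv
    simpa only [Prod.snd_sum, Prod.smul_snd, smul_eq_mul, ← negColumnEntropy_smul, ← pushX_smul,
      hcW] using this
  have hcard' : Fintype.card {z // c' z ≠ 0} ≤ Fintype.card (Fin (Fintype.card β + 1)) := by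
    simpa [Fintype.card_subtype] using hcard
  obtain ⟨e⟩ := Function.Embedding.nonempty_of_card_le hcard'
  let W' : Fin (Fintype.card β + 1) → β → ℝ :=
    Function.extend e (fun z => c' z • W z) 0
  have hsum : ∀ {M : Type} [AddCommMonoid M] (φ : (β → ℝ) → M), φ 0 = 0 →
      ∑ i, φ (W' i) = ∑ z, φ (c' z • W z) := fun φ hφ => by
    trans ∑ z : {z // c' z ≠ 0}, φ (c' z • W z)
    · refine (Fintype.sum_of_injective e e.injective _ _ (fun i hi => ?_) fun z => ?_).symm
      · have : W' i = 0 := Function.extend_apply' _ _ _ fun h => hi h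
        rw [this, hφ]
      · simp only [W', e.injective.extend_apply]
    · refine Fintype.sum_of_injective Subtype.val Subtype.val_injective _ _ (fun z hz => ?_)
        fun z => rfl
      have : c' z = 0 := by simpa using hz
      simp [this, hφ]
  refine ⟨W', ⟨fun i y => ?_, fun y => ?_⟩, ?_, ?_⟩
  · by_cases hi : ∃ z, e z = i
    · obtain ⟨z, rfl⟩ := hi
      simpa [W', e.injective.extend_apply] using mul_nonneg (hc' z) (hW.1 z y)
    · simp [W', Function.extend_apply' _ _ _ hi]
  · rw [hsum (fun w => w y) rfl, ← hW.2 y]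
    simpa using congrFun hv₁ y
  · rw [hsum (fun w => negColumnEntropy (pushX p w)) (by rw [pushX_zero, negColumnEntropy_zero]),
      hv₂]
  · rw [hsum negColumnEntropy negColumnEntropy_zero]
    exact hf

theorem isCompact_setOf_isCoupling (p : α × β → ℝ) :
    IsCompact {W : γ → β → ℝ | IsCoupling p W} := by
  refine (isCompact_Icc (a := 0) (b := fun _ => sndM p)).of_isClosed_subset ?_
    fun W hW => ⟨fun z y => hW.1 z y, fun z y => ?_⟩
  · simp only [IsCoupling, Set.ofPred_and, Set.ofPred_forall]
    exact (isClosed_iInter fun z => isClosed_iInter fun y =>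
      isClosed_le (by fun_prop) (by fun_prop)).inter
      (isClosed_iInter fun y => isClosed_eq (by fun_prop) (by fun_prop))
  · change W z y ≤ sndM p y
    rw [← hW.2 y]
    exact Finset.single_le_sum (f := fun z => W z y) (fun z _ => hW.1 z y) (Finset.mem_univ z)

theorem pushX_sndM (hp : IsPMF p) : pushX p (sndM p) = fstM p := by
  ext x
  simp only [pushX, condX_mul_sndM hp, fstM]

theorem IsPMF.fstM (hp : IsPMF p) : IsPMF (fstM p) :=
  ⟨fun x => Finset.sum_nonneg fun y _ => hp.1 (x, y), by
    rw [← hp.2, Fintype.sum_prod_type]; rfl⟩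

theorem IsPMF.negColumnEntropy {w : α → ℝ} (hw : IsPMF w) : negColumnEntropy w = -H w := by
  simp [_root_.negColumnEntropy, hw.2, H]

end Channel

/-- cardinality bound. For any `ε ≥ 0`, the supremum
defining `g_ε(X;Y)` over all finite-valued `Z` is attained by a `Z` taking
values in an alphabet of cardinality at most `|𝒴| + 1`. -/
theorem stmt17 {𝒳 𝒴 : Type*} [Fintype 𝒳] [Fintype 𝒴] (p : 𝒳 × 𝒴 → ℝ)
    (hp : IsPMF p) (ε : ℝ) (hε : 0 ≤ ε) :
    ∃ q : 𝒳 × 𝒴 × Fin (Fintype.card 𝒴 + 1) → ℝ,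
      IsPMF q ∧ m12 q = p ∧ Markov q ∧ MI (m13 q) ≤ ε ∧ MI (m23 q) = g ε p := by
  let S : Set (Fin (Fintype.card 𝒴 + 1) → 𝒴 → ℝ) :=
    {W | IsCoupling p W} ∩ {W | H (fstM p) + ∑ z, negColumnEntropy (pushX p (W z)) ≤ ε}
  have hS : IsCompact S := (isCompact_setOf_isCoupling p).inter_right <|
    isClosed_le (continuous_const.add <| continuous_finsetSum _ fun z _ =>
      continuous_negColumnEntropy.comp ((continuous_pushX p).comp (continuous_apply z)))
      continuous_const
  have hne : S.Nonempty := by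
    refine ⟨Pi.single 0 (sndM p), ⟨fun z y => ?_, fun y => ?_⟩, ?_⟩
    · by_cases hz : z = 0
      · subst hz
        simpa using sndM_nonneg hp y
      · simp [hz]
    · rw [Fintype.sum_eq_single 0 fun z hz => by simp [hz]]
      simp
    · rw [Set.mem_ofPred_eq, Fintype.sum_eq_single 0 fun z hz => by
        rw [Pi.single_eq_of_ne hz, pushX_zero, negColumnEntropy_zero]]
      rwa [Pi.single_eq_same, pushX_sndM hp, hp.fstM.negColumnEntropy, add_neg_cancel]
  obtain ⟨W, ⟨hW, hWε⟩, hmax⟩ := hS.exists_isMaxOn hne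
    (f := fun W => ∑ z, negColumnEntropy (W z)) (continuous_finsetSum _ fun z _ =>
      continuous_negColumnEntropy.comp (continuous_apply z)).continuousOn
  have hleak : MI (m13 (chainLaw p W)) ≤ ε := (hW.MI_m13_chainLaw hp).trans_le hWε
  refine ⟨chainLaw p W, hW.isPMF_chainLaw hp, hW.m12_chainLaw hp, hW.markov_chainLaw hp, hleak, ?_⟩
  have hgreatest : IsGreatest (PrivSet ε p) (MI (m23 (chainLaw p W))) := by
    refine ⟨⟨_, _, _, hW.isPMF_chainLaw hp, hW.m12_chainLaw hp, hW.markov_chainLaw hp, hleak, rfl⟩,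
      ?_⟩
    rintro _ ⟨γ, _, q, hq, h12, hM, hqε, rfl⟩
    obtain ⟨V, hV, rfl⟩ := exists_isCoupling_eq_chainLaw hp hq h12 hM
    obtain ⟨V', hV', hleak', hutil⟩ := hV.exists_fin
    rw [hV.MI_m13_chainLaw hp, ← hleak'] at hqε
    rw [hV.MI_m23_chainLaw hp, hW.MI_m23_chainLaw hp]
    gcongr
    exact hutil.trans (hmax ⟨hV', hqε⟩)
  exact hgreatest.csSup_eq.symm
end

section
/- (Binning lemma) Let r be a positive integer and let s, t be real numbers with r < s < t. Let P be a probability distribution on a finite set S such that P({y}) ≤ 2^{−t} for every y ∈ S. Then there exists a function f : S → {1, …, 2^r} such that Σ_{i=1}^{2^r} |P(f^{−1}(i)) − 2^{−r}| ≤ 2(2^{r−s} + 2^{−r} − 2^{−s}); in particular, the push-forward of P under f is within total variation distance 2(2^{r−s} + 2^{−r}) of the uniform distribution on {1, …, 2^r}. -/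
open scoped BigOperators Classical

/-- Nonnegative weights bounded by `δ` can be distributed among finitely many bins so that any two
bins differ by at most `δ`. -/
theorem exists_balanced_binning {S ι : Type*} [Finite ι] [Nonempty ι] [DecidableEq ι] (P : S → ℝ) {δ : ℝ}
    (hδ : 0 ≤ δ) (hP : ∀ y, 0 ≤ P y) (hPδ : ∀ y, P y ≤ δ) (T : Finset S) :
    ∃ f : S → ι, ∀ i j, ∑ y ∈ T.filter (fun y => f y = i), P y ≤
      ∑ y ∈ T.filter (fun y => f y = j), P y + δ := by
  induction T using Finset.induction_on with
  | empty => exact ⟨fun _ => Classical.arbitrary ι, by simpa using hδ⟩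
  | insert a T ha ih =>
    obtain ⟨f, hf⟩ := ih
    obtain ⟨k, hk⟩ := Finite.exists_min fun i => ∑ y ∈ T.filter (fun y => f y = i), P y
    have key : ∀ i, ∑ y ∈ (insert a T).filter (fun y => Function.update f a k y = i), P y =
        (if k = i then P a else 0) + ∑ y ∈ T.filter (fun y => f y = i), P y := by
      intro i
      rw [Finset.sum_filter, Finset.sum_insert ha, Finset.sum_filter, Function.update_self]
      congr 1
      refine Finset.sum_congr rfl fun y hy => ?_
      rw [Function.update_of_ne (ne_of_mem_of_not_mem hy ha)]
    refine ⟨Function.update f a k, fun i j => ?_⟩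
    rw [key, key]
    have h1 := hf i j
    have h2 := hk j
    have h3 := hP a
    have h4 := hPδ a
    split_ifs with hi hj hj
    · linarith
    · subst hi
      linarith
    · linarith
    · linarith

/-- A family of `N` reals whose pairwise differences are at most `δ` has total absolute deviation
from its mean at most `(N - 1) δ`. -/
theorem sum_abs_sub_mean_le {ι : Type*} [Fintype ι] [Nonempty ι] (q : ι → ℝ) {δ : ℝ}
    (hq : ∀ i j, q i ≤ q j + δ) :
    ∑ i, |q i - (Fintype.card ι : ℝ)⁻¹ * ∑ j, q j| ≤ ((Fintype.card ι : ℝ) - 1) * δ := by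
  have hN : (0 : ℝ) < Fintype.card ι := by exact_mod_cast Fintype.card_pos
  have hdev : ∀ i, |q i - (Fintype.card ι : ℝ)⁻¹ * ∑ j, q j| ≤
      (Fintype.card ι : ℝ)⁻¹ * (((Fintype.card ι : ℝ) - 1) * δ) := by
    intro i
    have heq : q i - (Fintype.card ι : ℝ)⁻¹ * ∑ j, q j =
        (Fintype.card ι : ℝ)⁻¹ * ∑ j, (q i - q j) := by
      rw [Finset.sum_sub_distrib, Finset.sum_const, Finset.card_univ, nsmul_eq_mul]
      field_simp
    rw [heq, abs_mul, abs_of_pos (inv_pos.2 hN)]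
    gcongr
    refine (Finset.abs_sum_le_sum_abs _ _).trans ?_
    rw [← Finset.add_sum_erase _ _ (Finset.mem_univ i), sub_self, abs_zero, zero_add]
    refine (Finset.sum_le_card_nsmul _ _ δ fun j _ => ?_).trans_eq ?_
    · rw [abs_le]
      constructor <;> linarith [hq i j, hq j i]
    · rw [Finset.card_erase_of_mem (Finset.mem_univ i), Finset.card_univ, nsmul_eq_mul,
        Nat.cast_sub Fintype.card_pos, Nat.cast_one]
  refine (Finset.sum_le_card_nsmul _ _ _ fun i _ => hdev i).trans_eq ?_
  rw [Finset.card_univ, nsmul_eq_mul]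
  field_simp

/-- binning lemma. Let `r` be a positive integer and
`s, t` reals with `r < s < t`.  If `P` is a probability distribution on a
finite set `S` with `P({y}) ≤ 2^{−t}` for every `y`, then there is a map
`f : S → {1,…,2^r}` whose push-forward of `P` satisfies
`Σᵢ |P(f⁻¹(i)) − 2^{−r}| ≤ 2(2^{r−s} + 2^{−r} − 2^{−s})`; in particular it is
within total variation distance `2(2^{r−s} + 2^{−r})` of the uniform
distribution on `{1,…,2^r}`. -/
theorem stmt19 {S : Type*} [Fintype S] (r : ℕ) (hr : 0 < r) (s t : ℝ)
    (hrs : (r : ℝ) < s) (hst : s < t)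
    (P : S → ℝ) (hP : IsPMF P) (hPsmall : ∀ y : S, P y ≤ (2 : ℝ) ^ (-t)) :
    ∃ f : S → Fin (2 ^ r),
      ((∑ i : Fin (2 ^ r),
          |(∑ y ∈ Finset.univ.filter fun y => f y = i, P y) - (2 : ℝ) ^ (-(r : ℝ))|) ≤
        2 * ((2 : ℝ) ^ ((r : ℝ) - s) + (2 : ℝ) ^ (-(r : ℝ)) - (2 : ℝ) ^ (-s))) ∧
      ((∑ i : Fin (2 ^ r),
          |(∑ y ∈ Finset.univ.filter fun y => f y = i, P y) - (2 : ℝ) ^ (-(r : ℝ))|) ≤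
        2 * ((2 : ℝ) ^ ((r : ℝ) - s) + (2 : ℝ) ^ (-(r : ℝ)))) := by
  have h2 : (0 : ℝ) < 2 := two_pos
  have hεt : (2 : ℝ) ^ (-t) ≤ 2 ^ (-s) :=
    Real.rpow_le_rpow_of_exponent_le one_le_two (by linarith)
  have hε : (0 : ℝ) < 2 ^ (-s) := Real.rpow_pos_of_pos h2 _
  have hinv : (0 : ℝ) < 2 ^ (-(r : ℝ)) := Real.rpow_pos_of_pos h2 _
  have hmul : (2 : ℝ) ^ ((r : ℝ) - s) = 2 ^ r * 2 ^ (-s) := by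
    rw [sub_eq_add_neg, Real.rpow_add h2, Real.rpow_natCast]
  have hN : (1 : ℝ) ≤ 2 ^ r := one_le_pow₀ one_le_two
  obtain ⟨f, hf⟩ := exists_balanced_binning (ι := Fin (2 ^ r)) P hε.le hP.1
    (fun y => (hPsmall y).trans hεt) Finset.univ
  have hsum : ∑ i, ∑ y ∈ Finset.univ.filter (fun y => f y = i), P y = 1 := by
    rw [Finset.sum_fiberwise, hP.2]
  have hdev := sum_abs_sub_mean_le _ hf
  rw [hsum, Fintype.card_fin, mul_one, Nat.cast_pow, Nat.cast_ofNat, ← Real.rpow_natCast,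
    ← Real.rpow_neg h2.le, Real.rpow_natCast] at hdev
  have hbound : ((2 : ℝ) ^ r - 1) * 2 ^ (-s) ≤
      2 * ((2 : ℝ) ^ ((r : ℝ) - s) + (2 : ℝ) ^ (-(r : ℝ)) - (2 : ℝ) ^ (-s)) := by
    rw [hmul]
    nlinarith [mul_nonneg (sub_nonneg.2 hN) hε.le]
  have hmain := hdev.trans hbound
  exact ⟨f, hmain, hmain.trans (by linarith)⟩
end
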